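/- Let n ≥ 1, let p ≠ q be two distinct points of the Riemann sphere Ĉ, and let C₁, …, Cₙ be non-separating continua in Ĉ such that: each Cᵢ contains both p and q; Cᵢ ∩ Cⱼ = {p, q} for all i ≠ j; and each set Cᵢ ∖ {p, q} is connected. Then the complement Ĉ ∖ (C₁ ∪ … ∪ Cₙ) has exactly n connected components, and each of these components is open and simply connected (as a topological subspace). -/

import Mathlib

open Set

/-- The Riemann sphere, as the one-point compactification of `ℂ`. -/
abbrev RSphere : Type := OnePoint ℂ

/-- A continuum in the Riemann sphere: a nonempty compact connected set. -/
def IsContinuum (C : Set RSphere) : Prop :=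
  C.Nonempty ∧ IsCompact C ∧ IsConnected C

/-- A set is non-separating if its complement in the sphere is nonempty and connected. -/
def NonSeparating (C : Set RSphere) : Prop :=
  Cᶜ.Nonempty ∧ IsConnected Cᶜ

/-- Edge labels `h` (horizontal) and `v` (vertical) of the lattice `ℤ × ℤ` commute around the unit
square with lower left corner `s`. -/
def FlatAt {G : Type*} [Group G] (h v : ℤ × ℤ → G) (s : ℤ × ℤ) : Prop :=
  h s * v (s.1 + 1, s.2) = v s * h (s.1, s.2 + 1)

/-- Two labellings of the edges of `ℤ × ℤ` agree on the boundary of the unit square `s`. -/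
def AgreeAt {G : Type*} (h v h' v' : ℤ × ℤ → G) (s : ℤ × ℤ) : Prop :=
  h' s = h s ∧ v' s = v s ∧ h' (s.1, s.2 + 1) = h (s.1, s.2 + 1) ∧
    v' (s.1 + 1, s.2) = v (s.1 + 1, s.2)

/-- Unit squares sharing an edge. -/
def EdgeAdj (s t : ℤ × ℤ) : Prop :=
  (t = (s.1 + 1, s.2) ∨ s = (t.1 + 1, t.2)) ∨ (t = (s.1, s.2 + 1) ∨ s = (t.1, t.2 + 1))

theorem FlatAt.of_agreeAt {G : Type*} [Group G] {h v h' v' : ℤ × ℤ → G} {s : ℤ × ℤ}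
    (hf : FlatAt h v s) (ha : AgreeAt h v h' v' s) : FlatAt h' v' s := by
  obtain ⟨h1, h2, h3, h4⟩ := ha
  simpa [FlatAt, h1, h2, h3, h4] using hf

/-- Relabelling the edge between `s` and `t` makes the labelling flat at `s` and changes it only
at `s` and `t`. -/
theorem EdgeAdj.exists_flatAt {G : Type*} [Group G] {s t : ℤ × ℤ} (hst : EdgeAdj s t)
    (h v : ℤ × ℤ → G) :
    ∃ h' v' : ℤ × ℤ → G, FlatAt h' v' s ∧ ∀ r, r ≠ s → r ≠ t → AgreeAt h v h' v' r := by
  classical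
  obtain ⟨i, j⟩ := s
  obtain ⟨k, l⟩ := t
  rcases hst with (hst | hst) | (hst | hst) <;> simp only [Prod.mk.injEq] at hst <;>
    obtain ⟨rfl, rfl⟩ := hst
  · refine ⟨h, Function.update v (i + 1, l) ((h (i, l))⁻¹ * (v (i, l) * h (i, l + 1))), ?_, ?_⟩
    · simp [FlatAt]
    · rintro ⟨a, b⟩ h1 h2
      simp only [ne_eq, Prod.mk.injEq, not_and, AgreeAt, Function.update_apply] at *
      grind
  · refine ⟨h, Function.update v (k + 1, j)
      ((h (k + 1, j)) * v (k + 1 + 1, j) * (h (k + 1, j + 1))⁻¹), ?_, ?_⟩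
    · simp [FlatAt]
    · rintro ⟨a, b⟩ h1 h2
      simp only [ne_eq, Prod.mk.injEq, not_and, AgreeAt, Function.update_apply] at *
      grind
  · refine ⟨Function.update h (k, j + 1) ((v (k, j))⁻¹ * (h (k, j) * v (k + 1, j))), v, ?_, ?_⟩
    · simp [FlatAt]
    · rintro ⟨a, b⟩ h1 h2
      simp only [ne_eq, Prod.mk.injEq, not_and, AgreeAt, Function.update_apply] at *
      grind
  · refine ⟨Function.update h (i, l + 1)
      ((v (i, l + 1)) * h (i, l + 1 + 1) * (v (i + 1, l + 1))⁻¹), v, ?_, ?_⟩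
    · simp [FlatAt]
    · rintro ⟨a, b⟩ h1 h2
      simp only [ne_eq, Prod.mk.injEq, not_and, AgreeAt, Function.update_apply] at *
      grind

/-- A labelling that is flat on `P` extends flatly over a finite set `T` of squares if each of
them has an adjacent square outside `P` of smaller rank. -/
theorem exists_flatAt_extension {G : Type*} [Group G] (P : Set (ℤ × ℤ)) (d : ℤ × ℤ → ℕ)
    (h v : ℤ × ℤ → G) (hP : ∀ s ∈ P, FlatAt h v s) (T : Finset (ℤ × ℤ))
    (hT : ∀ s ∈ T, s ∉ P ∧ ∃ t ∉ P, EdgeAdj s t ∧ d t < d s) :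
    ∃ h' v' : ℤ × ℤ → G, (∀ s ∈ P, AgreeAt h v h' v' s) ∧ (∀ s ∈ P, FlatAt h' v' s) ∧
      ∀ s ∈ T, FlatAt h' v' s := by
  classical
  induction T using Finset.induction_on_min_value d with
  | empty => exact ⟨h, v, fun _ _ ↦ ⟨rfl, rfl, rfl, rfl⟩, hP, by simp⟩
  | insert a T haT hmin ih =>
    obtain ⟨h₁, v₁, hag, hfl, hflT⟩ := ih fun s hs ↦ hT s (Finset.mem_insert_of_mem hs)
    obtain ⟨haP, t, htP, hat, hdt⟩ := hT a (Finset.mem_insert_self _ _)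
    have htT : t ∉ T := fun ht ↦ (hmin t ht).not_gt hdt
    obtain ⟨h₂, v₂, hfa, hag₂⟩ := hat.exists_flatAt h₁ v₁
    have key : ∀ s ∈ P, AgreeAt h₁ v₁ h₂ v₂ s := fun s hs ↦
      hag₂ s (ne_of_mem_of_not_mem hs haP) (ne_of_mem_of_not_mem hs htP)
    refine ⟨h₂, v₂, fun s hs ↦ ?_, fun s hs ↦ (hfl s hs).of_agreeAt (key s hs), fun s hs ↦ ?_⟩
    · have h1 := hag s hs
      have h2 := key s hs
      simp only [AgreeAt] at *
      grind
    · rcases Finset.mem_insert.1 hs with rfl | hs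
      · exact hfa
      · exact (hflT s hs).of_agreeAt
          (hag₂ s (ne_of_mem_of_not_mem hs haT) (ne_of_mem_of_not_mem hs htT))

/-- A labelling flat on a rectangle of squares has a potential. -/
theorem exists_potential_of_flatAt {G : Type*} [Group G] (h v : ℤ × ℤ → G) (N : ℕ)
    (hflat : ∀ i j : ℕ, i < N → j < N → FlatAt h v (i, j)) :
    ∃ g : ℤ × ℤ → G, ∀ i j : ℕ, i < N → j < N →
      g (i + 1, j) = g (i, j) * h (i, j) ∧ g (i, j + 1) = g (i, j) * v (i, j) ∧
      g (i + 1, j + 1) = g (i, j) * (h (i, j) * v (i + 1, j)) := by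
  obtain ⟨f, fv, f0⟩ : ∃ f : ℕ → ℕ → G, (∀ i j : ℕ, f i (j + 1) = f i j * v (i, j)) ∧
      ∀ i : ℕ, f (i + 1) 0 = f i 0 * h (i, 0) :=
    ⟨fun i j ↦ Nat.rec (Nat.rec 1 (fun k x ↦ x * h (k, 0)) i) (fun k x ↦ x * v (i, k)) j,
      fun _ _ ↦ rfl, fun _ ↦ rfl⟩
  have fh : ∀ j ≤ N, ∀ i < N, f (i + 1) j = f i j * h ((i : ℤ), (j : ℤ)) := by
    intro j
    induction j with
    | zero => intro _ i _; exact f0 i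
    | succ j ih =>
      intro hj i hi
      have := hflat i j hi (by omega)
      simp only [FlatAt] at this
      rw [fv, fv, ih (by omega) i hi, mul_assoc, mul_assoc]
      push_cast
      rw [this]
  refine ⟨fun s ↦ f s.1.toNat s.2.toNat, fun i j hi hj ↦ ?_⟩
  have e1 : ((i : ℤ) + 1).toNat = i + 1 := by omega
  have e2 : ((j : ℤ) + 1).toNat = j + 1 := by omega
  simp only [Int.toNat_natCast, e1, e2]
  refine ⟨fh j hj.le i hi, fv i j, ?_⟩
  rw [fv, fh j hj.le i hi, mul_assoc]
  push_cast
  rfl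

open Topology Filter OnePoint

/-- The closed square with index `s` of the grid with origin `c` and mesh `ε`. -/
def gridCell (c : ℂ) (ε : ℝ) (s : ℤ × ℤ) : Set ℂ :=
  {z | (s.1 ≤ (z.re - c.re) / ε ∧ (z.re - c.re) / ε ≤ s.1 + 1) ∧
    s.2 ≤ (z.im - c.im) / ε ∧ (z.im - c.im) / ε ≤ s.2 + 1}

/-- The vertex with index `s` of the grid with origin `c` and mesh `ε`. -/
def gridPoint (c : ℂ) (ε : ℝ) (s : ℤ × ℤ) : ℂ := ⟨c.re + ε * s.1, c.im + ε * s.2⟩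

/-- The index of a grid square containing `z`. -/
noncomputable def gridIndex (c : ℂ) (ε : ℝ) (z : ℂ) : ℤ × ℤ :=
  (⌊(z.re - c.re) / ε⌋, ⌊(z.im - c.im) / ε⌋)

section Grid

variable {c : ℂ} {ε : ℝ}

theorem mem_gridCell_gridIndex (z : ℂ) : z ∈ gridCell c ε (gridIndex c ε z) :=
  ⟨⟨Int.floor_le _, (Int.lt_floor_add_one _).le⟩, Int.floor_le _, (Int.lt_floor_add_one _).le⟩

theorem eventually_floor_le_and_le_floor_add_one (r : ℝ) :
    ∀ᶠ t : ℝ in 𝓝 r, (⌊t⌋ : ℝ) ≤ r ∧ r ≤ ⌊t⌋ + 1 := by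
  have h1 : ∀ᶠ t : ℝ in 𝓝 r, t < ⌊r⌋ + 1 := eventually_lt_nhds (Int.lt_floor_add_one r)
  have h2 : ∀ᶠ t : ℝ in 𝓝 r, (⌈r⌉ : ℝ) - 1 < t :=
    eventually_gt_nhds (by linarith [Int.ceil_lt_add_one r])
  filter_upwards [h1, h2] with t h1 h2
  constructor
  · have : ⌊t⌋ ≤ ⌊r⌋ := Int.lt_add_one_iff.1 (Int.floor_lt.2 (by exact_mod_cast h1))
    exact (Int.cast_le.2 this).trans (Int.floor_le r)
  · have : ⌈r⌉ - 1 ≤ ⌊t⌋ := Int.le_floor.2 (by push_cast; exact h2.le)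
    have h3 : ((⌈r⌉ - 1 : ℤ) : ℝ) ≤ ⌊t⌋ := Int.cast_le.2 this
    push_cast at h3
    linarith [Int.le_ceil r]

theorem eventually_mem_gridCell_gridIndex (x : ℂ) :
    ∀ᶠ y in 𝓝 x, x ∈ gridCell c ε (gridIndex c ε y) := by
  have h1 : Tendsto (fun y : ℂ ↦ (y.re - c.re) / ε) (𝓝 x) (𝓝 ((x.re - c.re) / ε)) :=
    Continuous.tendsto (by fun_prop) x
  have h2 : Tendsto (fun y : ℂ ↦ (y.im - c.im) / ε) (𝓝 x) (𝓝 ((x.im - c.im) / ε)) :=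
    Continuous.tendsto (by fun_prop) x
  exact (h1.eventually (eventually_floor_le_and_le_floor_add_one _)).and
    (h2.eventually (eventually_floor_le_and_le_floor_add_one _))

theorem gridCell_eq_reProdIm (hε : 0 < ε) (s : ℤ × ℤ) :
    gridCell c ε s = Icc (c.re + ε * s.1) (c.re + ε * (s.1 + 1)) ×ℂ
      Icc (c.im + ε * s.2) (c.im + ε * (s.2 + 1)) := by
  ext z
  simp only [gridCell, mem_ofPred_eq, Complex.mem_reProdIm, mem_Icc, le_div_iff₀ hε,
    div_le_iff₀ hε]
  constructor <;> rintro ⟨⟨h1, h2⟩, h3, h4⟩ <;> refine ⟨⟨?_, ?_⟩, ?_, ?_⟩ <;> linarith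

theorem isCompact_gridCell (hε : 0 < ε) (s : ℤ × ℤ) : IsCompact (gridCell c ε s) := by
  rw [gridCell_eq_reProdIm hε]
  exact isCompact_Icc.reProdIm isCompact_Icc

theorem convex_gridCell (hε : 0 < ε) (s : ℤ × ℤ) : Convex ℝ (gridCell c ε s) := by
  rw [gridCell_eq_reProdIm hε]
  exact ((convex_Icc _ _).linear_preimage Complex.reLm).inter
    ((convex_Icc _ _).linear_preimage Complex.imLm)

theorem gridPoint_mem_gridCell (hε : 0 < ε) {s t : ℤ × ℤ} (h1 : t.1 = s.1 ∨ t.1 = s.1 + 1)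
    (h2 : t.2 = s.2 ∨ t.2 = s.2 + 1) : gridPoint c ε t ∈ gridCell c ε s := by
  simp only [gridCell, gridPoint, mem_ofPred_eq, add_sub_cancel_left,
    mul_div_cancel_left₀ _ hε.ne']
  refine ⟨?_, ?_⟩
  · rcases h1 with h | h <;> rw [h] <;> push_cast <;> constructor <;> linarith
  · rcases h2 with h | h <;> rw [h] <;> push_cast <;> constructor <;> linarith

theorem dist_le_of_mem_gridCell (hε : 0 < ε) {s : ℤ × ℤ} {x y : ℂ} (hx : x ∈ gridCell c ε s)
    (hy : y ∈ gridCell c ε s) : dist x y ≤ 2 * ε := by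
  rw [gridCell_eq_reProdIm hε] at hx hy
  simp only [Complex.mem_reProdIm, mem_Icc] at hx hy
  rw [dist_eq_norm]
  refine (Complex.norm_le_abs_re_add_abs_im _).trans ?_
  have h1 : |(x - y).re| ≤ ε := by
    rw [Complex.sub_re, abs_le]; constructor <;> linarith [hx.1.1, hx.1.2, hy.1.1, hy.1.2]
  have h2 : |(x - y).im| ≤ ε := by
    rw [Complex.sub_im, abs_le]; constructor <;> linarith [hx.2.1, hx.2.2, hy.2.1, hy.2.2]
  linarith

theorem abs_sub_le_one_of_mem_gridCell {s t : ℤ × ℤ} {x : ℂ} (hs : x ∈ gridCell c ε s)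
    (ht : x ∈ gridCell c ε t) :
    (s.1 ≤ t.1 + 1 ∧ t.1 ≤ s.1 + 1) ∧ s.2 ≤ t.2 + 1 ∧ t.2 ≤ s.2 + 1 := by
  obtain ⟨⟨a1, a2⟩, a3, a4⟩ := hs
  obtain ⟨⟨b1, b2⟩, b3, b4⟩ := ht
  refine ⟨⟨?_, ?_⟩, ?_, ?_⟩ <;> refine Int.cast_le (R := ℝ).1 ?_ <;> push_cast <;> linarith

/-- Any two grid squares at a point are joined by a chain of adjacent squares at that point. -/
theorem mem_of_mem_gridCell_of_edgeAdj {x : ℂ} {U : Set (ℤ × ℤ)} {s t : ℤ × ℤ}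
    (hU : ∀ s ∈ U, ∀ t, EdgeAdj s t → x ∈ gridCell c ε t → t ∈ U) (hsU : s ∈ U)
    (hs : x ∈ gridCell c ε s) (ht : x ∈ gridCell c ε t) : t ∈ U := by
  obtain ⟨⟨h1, h2⟩, h3, h4⟩ := abs_sub_le_one_of_mem_gridCell hs ht
  have hr : x ∈ gridCell c ε (t.1, s.2) := ⟨ht.1, hs.2⟩
  have hrU : (t.1, s.2) ∈ U := by
    rcases eq_or_ne s (t.1, s.2) with h | h
    · rwa [← h]
    · refine hU s hsU _ (Or.inl ?_) hr
      obtain ⟨i, j⟩ := s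
      simp only [ne_eq, Prod.mk.injEq, and_true] at *
      omega
  rcases eq_or_ne t (t.1, s.2) with h | h
  · rwa [h]
  · refine hU _ hrU _ (Or.inr ?_) ht
    obtain ⟨i, j⟩ := t
    simp only [ne_eq, Prod.mk.injEq, true_and] at *
    omega

/-- If the complement of `D` in the sphere is connected, then every square of a finite block that
meets this complement can be joined to the outside of the block by adjacent such squares. -/
theorem exists_rank_of_isPreconnected_compl {D : Set ℂ}
    (hDc : IsPreconnected ((↑) '' D : Set (OnePoint ℂ))ᶜ) (hε : 0 < ε) (B : Finset (ℤ × ℤ)) :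
    ∃ d : ℤ × ℤ → ℕ, ∀ s ∈ B, ¬ gridCell c ε s ⊆ D →
      ∃ t, ¬ (t ∈ B ∧ gridCell c ε t ⊆ D) ∧ EdgeAdj s t ∧ d t < d s := by
  classical
  let P : Set (ℤ × ℤ) := {s | s ∈ B ∧ gridCell c ε s ⊆ D}
  obtain ⟨R, R0, RS⟩ : ∃ R : ℕ → Set (ℤ × ℤ), (∀ s, s ∈ R 0 ↔ s ∉ B) ∧
      ∀ n s, s ∈ R (n + 1) ↔ s ∉ P ∧ ∃ t ∈ R n, EdgeAdj s t :=
    ⟨fun n ↦ Nat.rec {s | s ∉ B} (fun _ S ↦ {s | s ∉ P ∧ ∃ t ∈ S, EdgeAdj s t}) n,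
      fun _ ↦ Iff.rfl, fun _ _ ↦ Iff.rfl⟩
  have RP : ∀ n, ∀ s ∈ R n, s ∉ P := by
    rintro (_ | n) s hs hP
    · exact (R0 s).1 hs hP.1
    · exact ((RS n s).1 hs).1 hP
  have hreach : ∀ s ∈ B, ¬ gridCell c ε s ⊆ D → ∃ n, s ∈ R n := by
    by_contra! hcon
    obtain ⟨s₀, hs₀B, hs₀D, hs₀⟩ := hcon
    let U : Set (ℤ × ℤ) := {s | s ∈ B ∧ ¬ gridCell c ε s ⊆ D ∧ ∀ n, s ∉ R n}
    have hUadj : ∀ s ∈ U, ∀ t, EdgeAdj s t → t ∉ P → t ∈ U := by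
      intro s hs t hst htP
      have hsP : s ∉ P := fun h ↦ hs.2.1 h.2
      have htR : ∀ n, t ∉ R n := fun n htn ↦ hs.2.2 (n + 1) ((RS n s).2 ⟨hsP, t, htn, hst⟩)
      have htB : t ∈ B := by_contra fun h ↦ htR 0 ((R0 t).2 h)
      exact ⟨htB, fun h ↦ htP ⟨htB, h⟩, htR⟩
    have hUfin : U.Finite := B.finite_toSet.subset fun s hs ↦ hs.1
    have hF : IsCompact (⋃ s ∈ U, gridCell c ε s) :=
      hUfin.isCompact_biUnion fun s _ ↦ isCompact_gridCell hε s
    have hint : ∀ x ∉ D, x ∈ ⋃ s ∈ U, gridCell c ε s →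
        x ∈ interior (⋃ s ∈ U, gridCell c ε s) := by
      intro x hxD hx
      obtain ⟨s, hsU, hxs⟩ := mem_iUnion₂.1 hx
      rw [mem_interior_iff_mem_nhds]
      filter_upwards [eventually_mem_gridCell_gridIndex (c := c) (ε := ε) x] with y hy
      refine mem_iUnion₂.2 ⟨_, mem_of_mem_gridCell_of_edgeAdj ?_ hsU hxs hy,
        mem_gridCell_gridIndex y⟩
      exact fun s hs t hst hxt ↦ hUadj s hs t hst fun h ↦ hxD (h.2 hxt)
    obtain ⟨x₀, hx₀s, hx₀D⟩ := not_subset.1 hs₀D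
    have hx₀F : x₀ ∈ ⋃ s ∈ U, gridCell c ε s := mem_iUnion₂.2 ⟨s₀, ⟨hs₀B, hs₀D, hs₀⟩, hx₀s⟩
    obtain ⟨z, -, hz1, hz2⟩ := hDc ((↑) '' interior (⋃ s ∈ U, gridCell c ε s))
      ((↑) '' (⋃ s ∈ U, gridCell c ε s))ᶜ (isOpenEmbedding_coe.isOpenMap _ isOpen_interior)
      (hF.image continuous_coe).isClosed.isOpen_compl
      (by
        intro z hz
        induction z with
        | infty => exact Or.inr infty_notMem_image_coe
        | coe z =>
          by_cases hzF : z ∈ ⋃ s ∈ U, gridCell c ε s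
          · exact Or.inl ⟨z, hint z (fun h ↦ hz ⟨z, h, rfl⟩) hzF, rfl⟩
          · exact Or.inr fun ⟨w, hw, hwz⟩ ↦ hzF (coe_injective hwz ▸ hw))
      ⟨x₀, fun ⟨w, hw, hwz⟩ ↦ hx₀D (coe_injective hwz ▸ hw), x₀, hint x₀ hx₀D hx₀F, rfl⟩
      ⟨∞, infty_notMem_image_coe, infty_notMem_image_coe⟩
    exact hz2 (image_mono interior_subset hz1)
  refine ⟨fun s ↦ if h : ∃ n, s ∈ R n then Nat.find h else 0, fun s hsB hsD ↦ ?_⟩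
  have hs := hreach s hsB hsD
  obtain ⟨m, hm⟩ : ∃ m, Nat.find hs = m + 1 := Nat.exists_eq_succ_of_ne_zero fun h ↦
    (R0 s).1 (h ▸ Nat.find_spec hs) hsB
  obtain ⟨-, t, htm, hst⟩ := (RS m s).1 (hm ▸ Nat.find_spec hs)
  refine ⟨t, RP m t htm, hst, ?_⟩
  have ht : ∃ n, t ∈ R n := ⟨m, htm⟩
  simp only [dif_pos hs, dif_pos ht, hm]
  exact Nat.lt_succ_of_le (Nat.find_min' ht htm)

end Grid

/-- A multiplicative cocycle on the convex subsets of a plane open set whose complement in the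
sphere is connected is locally a coboundary along every compact set. -/
theorem exists_potential_of_isPreconnected_compl {G : Type*} [Group G] {D : Set ℂ}
    (hD : IsOpen D) (hDc : IsPreconnected ((↑) '' D : Set (OnePoint ℂ))ᶜ) (l : ℂ → ℂ → G)
    (hl : ∀ S ⊆ D, Convex ℝ S → ∀ x ∈ S, ∀ y ∈ S, ∀ z ∈ S, l x y * l y z = l x z)
    {K : Set ℂ} (hK : IsCompact K) (hKD : K ⊆ D) :
    ∃ g : ℂ → G, ∀ x ∈ K, ∀ᶠ y in 𝓝 x, g y = g x * l x y := by
  classical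
  obtain ⟨δ, hδ, hδD⟩ := hK.exists_cthickening_subset_open hD hKD
  set ε := δ / 2 with hεδ
  have hε : 0 < ε := by positivity
  obtain ⟨R, hR⟩ := hK.isBounded.subset_closedBall 0
  obtain ⟨N, hN⟩ := exists_nat_gt ((2 * R + ε) / ε)
  let c : ℂ := ⟨-(R + ε), -(R + ε)⟩
  have hbound : ∀ (r : ℝ) (k : ℤ), |r| ≤ R → k ≤ (r - -(R + ε)) / ε →
      (r - -(R + ε)) / ε ≤ k + 1 → 0 ≤ k ∧ k < N := by
    intro r k hr h1 h2
    obtain ⟨hr1, hr2⟩ := abs_le.1 hr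
    have h3 : 1 ≤ (r - -(R + ε)) / ε := by rw [le_div_iff₀ hε]; linarith
    have h4 : (r - -(R + ε)) / ε ≤ (2 * R + ε) / ε := by gcongr; linarith
    constructor
    · have : (0 : ℝ) ≤ k := by linarith
      exact_mod_cast this
    · have : (k : ℝ) < N := by linarith
      exact_mod_cast this
  let B : Finset (ℤ × ℤ) := Finset.Ico (0 : ℤ) N ×ˢ Finset.Ico (0 : ℤ) N
  have hgood : ∀ x ∈ K, ∀ s, x ∈ gridCell c ε s → s ∈ B ∧ gridCell c ε s ⊆ D := by
    intro x hx s hs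
    have hxR : ‖x‖ ≤ R := by simpa using hR hx
    constructor
    · have h1 := hbound _ _ ((Complex.abs_re_le_norm x).trans hxR) hs.1.1 hs.1.2
      have h2 := hbound _ _ ((Complex.abs_im_le_norm x).trans hxR) hs.2.1 hs.2.2
      simp [B, h1, h2]
    · refine Subset.trans (fun y hy ↦ ?_) hδD
      exact Metric.mem_cthickening_of_dist_le y x δ K hx
        ((dist_le_of_mem_gridCell hε hy hs).trans (by rw [hεδ]; linarith))
  let P : Set (ℤ × ℤ) := {s | s ∈ B ∧ gridCell c ε s ⊆ D}
  let pt := gridPoint c ε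
  obtain ⟨d, hd⟩ := exists_rank_of_isPreconnected_compl (c := c) hDc hε B
  have hcell : ∀ s ∈ P, ∀ x ∈ gridCell c ε s, ∀ y ∈ gridCell c ε s, ∀ z ∈ gridCell c ε s,
      l x y * l y z = l x z := fun s hs ↦ hl _ hs.2 (convex_gridCell hε s)
  obtain ⟨h, v, hagree, hflatP, hflatT⟩ := exists_flatAt_extension P d
    (fun s ↦ l (pt s) (pt (s.1 + 1, s.2))) (fun s ↦ l (pt s) (pt (s.1, s.2 + 1)))
    (fun s hs ↦ by
      have h00 : pt s ∈ gridCell c ε s := gridPoint_mem_gridCell hε (by simp) (by simp)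
      have h10 : pt (s.1 + 1, s.2) ∈ gridCell c ε s :=
        gridPoint_mem_gridCell hε (by simp) (by simp)
      have h01 : pt (s.1, s.2 + 1) ∈ gridCell c ε s :=
        gridPoint_mem_gridCell hε (by simp) (by simp)
      have h11 : pt (s.1 + 1, s.2 + 1) ∈ gridCell c ε s :=
        gridPoint_mem_gridCell hε (by simp) (by simp)
      exact (hcell s hs _ h00 _ h10 _ h11).trans (hcell s hs _ h00 _ h01 _ h11).symm)
    (B.filter (· ∉ P))
    (fun s hs ↦ by
      rw [Finset.mem_filter] at hs
      exact ⟨hs.2, hd s hs.1 fun h ↦ hs.2 ⟨hs.1, h⟩⟩)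
  obtain ⟨g, hg⟩ := exists_potential_of_flatAt h v N fun i j hi hj ↦ by
    by_cases hs : ((i : ℤ), (j : ℤ)) ∈ P
    · exact hflatP _ hs
    · exact hflatT _ (Finset.mem_filter.2 ⟨by simp [B, hi, hj], hs⟩)
  have hcorner : ∀ s ∈ P, ∀ x ∈ gridCell c ε s, ∀ t : ℤ × ℤ, (t.1 = s.1 ∨ t.1 = s.1 + 1) →
      (t.2 = s.2 ∨ t.2 = s.2 + 1) → g s * l (pt s) x = g t * l (pt t) x := by
    intro s hs x hx t h1 h2
    have hs0 : pt s ∈ gridCell c ε s := gridPoint_mem_gridCell hε (by simp) (by simp)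
    have ht : pt t ∈ gridCell c ε s := gridPoint_mem_gridCell hε h1 h2
    suffices hgt : g t = g s * l (pt s) (pt t) by
      rw [hgt, mul_assoc, hcell s hs _ hs0 _ ht _ hx]
    obtain ⟨a1, a2, a3, a4⟩ := hagree s hs
    have hsB := hs.1
    simp only [B, Finset.mem_product, Finset.mem_Ico] at hsB
    obtain ⟨i, hi⟩ := Int.eq_ofNat_of_zero_le hsB.1.1
    obtain ⟨j, hj⟩ := Int.eq_ofNat_of_zero_le hsB.2.1
    obtain ⟨s1, s2⟩ := s
    obtain ⟨t1, t2⟩ := t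
    simp only at hi hj h1 h2 a1 a2 a3 a4 hsB
    subst hi hj
    obtain ⟨g1, g2, g3⟩ := hg i j (by omega) (by omega)
    have h10 : pt ((i : ℤ) + 1, (j : ℤ)) ∈ gridCell c ε (i, j) :=
      gridPoint_mem_gridCell hε (by simp) (by simp)
    have h11 : pt ((i : ℤ) + 1, (j : ℤ) + 1) ∈ gridCell c ε (i, j) :=
      gridPoint_mem_gridCell hε (by simp) (by simp)
    rcases h1 with rfl | rfl <;> rcases h2 with rfl | rfl
    · have := hcell _ hs _ hs0 _ hs0 _ hs0
      rw [mul_eq_left] at this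
      rw [this, mul_one]
    · rw [g2, a2]
    · rw [g1, a1]
    · rw [g3, a1, a4]
      exact congrArg _ (hcell _ hs _ hs0 _ h10 _ h11)
  refine ⟨fun x ↦ g (gridIndex c ε x) * l (pt (gridIndex c ε x)) x, fun x hx ↦ ?_⟩
  filter_upwards [eventually_mem_gridCell_gridIndex (c := c) (ε := ε) x] with y hy
  have hxs := mem_gridCell_gridIndex (c := c) (ε := ε) x
  have hys := mem_gridCell_gridIndex (c := c) (ε := ε) y
  set s := gridIndex c ε x
  set t := gridIndex c ε y
  have hsP : s ∈ P := hgood x hx s hxs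
  have htP : t ∈ P := hgood x hx t hy
  have ht0 : pt t ∈ gridCell c ε t := gridPoint_mem_gridCell hε (by simp) (by simp)
  obtain ⟨⟨d1, d2⟩, d3, d4⟩ := abs_sub_le_one_of_mem_gridCell hxs hy
  rw [hcorner s hsP x hxs (max s.1 t.1, max s.2 t.2) (by simp only; omega) (by simp only; omega),
    ← hcorner t htP x hy (max s.1 t.1, max s.2 t.2) (by simp only; omega) (by simp only; omega),
    mul_assoc, hcell t htP _ ht0 _ hy _ hys]

/-- Path classes in a path connected space can be turned multiplicatively and faithfully into
elements of the fundamental group. -/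
theorem exists_quotient_to_fundamentalGroup {X : Type*} [TopologicalSpace X] [PathConnectedSpace X]
    (x : X) : ∃ cls : ∀ a b : X, Path.Homotopic.Quotient a b → FundamentalGroup X x,
      (∀ a b c (p : Path.Homotopic.Quotient a b) (q : Path.Homotopic.Quotient b c),
        cls a c (p.trans q) = cls b c q * cls a b p) ∧
      ∀ a (p : Path.Homotopic.Quotient a a), cls a a p = 1 → p = .refl a := by
  let c : ∀ a, Path.Homotopic.Quotient x a := fun a ↦ .mk (PathConnectedSpace.somePath x a)
  refine ⟨fun a b p ↦ ((c a).trans p).trans (c b).symm, fun a b e p q ↦ ?_, fun a p hp ↦ ?_⟩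
  · rw [FundamentalGroup.mul_def]
    simp only [Path.Homotopic.Quotient.trans_assoc]
    rw [← Path.Homotopic.Quotient.trans_assoc (c b).symm (c b),
      Path.Homotopic.Quotient.symm_trans, Path.Homotopic.Quotient.refl_trans]
  · have hp : ((c a).trans p).trans (c a).symm = .refl x := hp
    calc p = ((c a).symm.trans (((c a).trans p).trans (c a).symm)).trans (c a) := by
          simp only [Path.Homotopic.Quotient.trans_assoc, Path.Homotopic.Quotient.symm_trans,
            Path.Homotopic.Quotient.trans_refl]
          rw [← Path.Homotopic.Quotient.trans_assoc, Path.Homotopic.Quotient.symm_trans,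
            Path.Homotopic.Quotient.refl_trans]
      _ = .refl a := by
          rw [hp, Path.Homotopic.Quotient.trans_refl, Path.Homotopic.Quotient.symm_trans]

/-- Paths with the same ends inside a convex subset of `D` are homotopic in `D`. -/
theorem Path.homotopic_of_convex {E : Type*} [AddCommGroup E] [Module ℝ E] [TopologicalSpace E]
    [IsTopologicalAddGroup E] [ContinuousSMul ℝ E] {D S : Set E} (hS : Convex ℝ S) (hSD : S ⊆ D)
    {a b : D} (γ γ' : Path a b) (h : ∀ t, (γ t : E) ∈ S) (h' : ∀ t, (γ' t : E) ∈ S) :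
    γ.Homotopic γ' := by
  have ha : (a : E) ∈ S := by simpa using h 0
  have hb : (b : E) ∈ S := by simpa using h 1
  have : ContractibleSpace S := hS.contractibleSpace ⟨a, ha⟩
  let lift : ∀ η : Path a b, (∀ t, (η t : E) ∈ S) → Path (⟨a, ha⟩ : S) ⟨b, hb⟩ := fun η hη ↦
    { toFun := fun t ↦ ⟨η t, hη t⟩
      source' := by simp
      target' := by simp }
  exact (SimplyConnectedSpace.paths_homotopic (lift γ h) (lift γ' h')).map
    ⟨inclusion hSD, continuous_inclusion hSD⟩

/-- A connected plane open set whose complement in the sphere is connected is simply connected. -/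
theorem isSimplyConnected_of_isPreconnected_compl {D : Set ℂ} (hD : IsOpen D)
    (hDconn : IsConnected D) (hDc : IsPreconnected ((↑) '' D : Set (OnePoint ℂ))ᶜ) :
    IsSimplyConnected D := by
  classical
  have hpath : IsPathConnected D := hD.isConnected_iff_isPathConnected.1 hDconn
  have := isPathConnected_iff_pathConnectedSpace.1 hpath
  rw [IsSimplyConnected, simply_connected_iff_loops_nullhomotopic]
  refine ⟨inferInstance, fun x γ ↦ ?_⟩
  obtain ⟨cls, hmul, hone⟩ := exists_quotient_to_fundamentalGroup x
  have hjoin : ∀ S ⊆ D, Convex ℝ S → ∀ a b : D, (a : ℂ) ∈ S → (b : ℂ) ∈ S →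
      ∃ η : Path b a, ∀ t, (η t : ℂ) ∈ S := by
    intro S hSD hS a b ha hb
    have hmem : ∀ t : unitInterval, AffineMap.lineMap (b : ℂ) (a : ℂ) (t : ℝ) ∈ S :=
      fun t ↦ hS.segment_subset hb ha (lineMap_mem_segment ℝ _ _ t.2)
    exact ⟨⟨⟨fun t ↦ ⟨AffineMap.lineMap (b : ℂ) (a : ℂ) (t : ℝ), hSD (hmem t)⟩,
      by fun_prop⟩, by simp, by simp⟩, hmem⟩
  -- `l a b` is the class of the segment from `b` to `a`, whenever it lies in `D`
  obtain ⟨l, hl⟩ : ∃ l : ℂ → ℂ → FundamentalGroup D x, ∀ S ⊆ D, Convex ℝ S → ∀ (a b : D)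
      (η : Path b a), (∀ t, (η t : ℂ) ∈ S) → l a b = cls b a (.mk η) := by
    refine ⟨fun a b ↦ if h : ∃ η : Σ a' b' : D, Path b' a', (η.1 : ℂ) = a ∧ (η.2.1 : ℂ) = b ∧
      ∀ t, (η.2.2 t : ℂ) ∈ segment ℝ b a then cls _ _ (.mk h.choose.2.2) else 1,
      fun S hSD hS a b η hη ↦ ?_⟩
    have ha : (a : ℂ) ∈ S := by simpa using hη 1
    have hb : (b : ℂ) ∈ S := by simpa using hη 0
    have hseg : segment ℝ (b : ℂ) a ⊆ S := hS.segment_subset hb ha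
    have hex : ∃ η : Σ a' b' : D, Path b' a', (η.1 : ℂ) = a ∧ (η.2.1 : ℂ) = b ∧
        ∀ t, (η.2.2 t : ℂ) ∈ segment ℝ (b : ℂ) a := by
      obtain ⟨η', hη'⟩ := hjoin _ (hseg.trans hSD) (convex_segment _ _) a b
        (right_mem_segment ℝ _ _) (left_mem_segment ℝ _ _)
      exact ⟨⟨a, b, η'⟩, rfl, rfl, hη'⟩
    simp only [dif_pos hex]
    obtain ⟨h1, h2, h3⟩ := hex.choose_spec
    generalize hex.choose = ζ at h1 h2 h3
    obtain ⟨a', b', ζ⟩ := ζ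
    obtain rfl := Subtype.ext h1
    obtain rfl := Subtype.ext h2
    exact congrArg _ (Path.Homotopic.Quotient.eq.2
      (Path.homotopic_of_convex hS hSD _ _ (fun t ↦ hseg (h3 t)) hη))
  have hcocycle : ∀ S ⊆ D, Convex ℝ S → ∀ a ∈ S, ∀ b ∈ S, ∀ c ∈ S, l a b * l b c = l a c := by
    intro S hSD hS a ha b hb c hc
    obtain ⟨η, hη⟩ := hjoin S hSD hS ⟨a, hSD ha⟩ ⟨b, hSD hb⟩ ha hb
    obtain ⟨ζ, hζ⟩ := hjoin S hSD hS ⟨b, hSD hb⟩ ⟨c, hSD hc⟩ hb hc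
    have hηζ : ∀ t, (ζ.trans η t : ℂ) ∈ S := by
      intro t
      have : (ζ.trans η) t ∈ range ζ ∪ range η := by
        rw [← Path.trans_range]; exact mem_range_self t
      rcases this with ⟨s, hs⟩ | ⟨s, hs⟩
      · rw [← hs]; exact hζ s
      · rw [← hs]; exact hη s
    have e1 := hl S hSD hS _ _ η hη
    have e2 := hl S hSD hS _ _ ζ hζ
    have e3 := hl S hSD hS _ _ _ hηζ
    simp only at e1 e2 e3
    rw [e1, e2, e3, Path.Homotopic.Quotient.mk_trans, hmul]
  obtain ⟨g, hg⟩ := exists_potential_of_isPreconnected_compl hD hDc l hcocycle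
    (isCompact_range (f := fun t ↦ (γ t : ℂ)) (by fun_prop)) (range_subset_iff.2 fun t ↦ (γ t).2)
  let e : unitInterval → FundamentalGroup D x := fun t ↦ cls _ _ (.mk (γ.subpath t 0))
  have hconst : IsLocallyConstant fun t ↦ g (γ t) * (e t)⁻¹ := by
    rw [IsLocallyConstant.iff_eventually_eq]
    intro t
    obtain ⟨r, hr, hrD⟩ := Metric.isOpen_iff.1 hD (γ t) (γ t).2
    have hcont : Continuous fun t ↦ (γ t : ℂ) := by fun_prop
    have hball : (fun t ↦ (γ t : ℂ)) ⁻¹' Metric.ball (γ t) r ∈ 𝓝 t :=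
      hcont.continuousAt.preimage_mem_nhds (Metric.ball_mem_nhds _ hr)
    obtain ⟨V, hV, hVc, hVball⟩ : ∃ V ∈ 𝓝 t, OrdConnected V ∧
        V ⊆ (fun t ↦ (γ t : ℂ)) ⁻¹' Metric.ball (γ t) r := by
      obtain ⟨ρ, hρ, hρV⟩ := Metric.mem_nhds_iff.1 hball
      refine ⟨_, Metric.ball_mem_nhds t hρ, ⟨fun a ha b hb c hc ↦ ?_⟩, hρV⟩
      simp only [Metric.mem_ball, Subtype.dist_eq, Real.dist_eq, abs_lt] at *
      have h1 : (a : ℝ) ≤ c := hc.1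
      have h2 : (c : ℝ) ≤ b := hc.2
      constructor <;> linarith
    filter_upwards [hV, hcont.continuousAt.eventually (hg _ (mem_range_self t))] with t' ht' hgt'
    have hsub : ∀ s, (γ.subpath t' t s : ℂ) ∈ Metric.ball (γ t : ℂ) r := by
      intro s
      have : γ.subpath t' t s ∈ γ '' uIcc t' t := by
        rw [← Path.range_subpath]; exact mem_range_self s
      obtain ⟨u, hu, hus⟩ := this
      rw [← hus]
      exact hVball (hVc.uIcc_subset ht' (mem_of_mem_nhds hV) hu)
    have h1 : l (γ t) (γ t') = cls _ _ (.mk (γ.subpath t' t)) :=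
      hl _ hrD (convex_ball _ _) _ _ _ hsub
    have h2 : e t' = e t * l (γ t) (γ t') := by
      rw [h1, ← hmul, ← Path.Homotopic.Quotient.mk_trans]
      exact congrArg _ (Path.Homotopic.Quotient.eq.2
        ⟨(Path.Homotopy.subpathTransSubpath γ t' t 0).symm⟩)
    rw [hgt', h2]
    group
  have hrefl : ∀ a, cls a a (.refl a) = 1 := fun a ↦ by
    have := hmul a a a (.refl a) (.refl a)
    rw [Path.Homotopic.Quotient.trans_refl] at this
    exact left_eq_mul.1 this
  have h01 := hconst.apply_eq_of_preconnectedSpace 0 1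
  have e0 : e 0 = 1 := by
    simp only [e, Path.subpath_self]
    exact hrefl _
  have e1 : e 1 = 1 := by
    have hγ : (γ 0 : D) = γ 1 := by simp
    rw [hγ, e0] at h01
    exact (inv_injective (mul_left_cancel h01)).symm
  have hcast : ∀ (a b : D) (ha : a = x) (hb : b = x),
      cls _ _ (.mk (γ.symm.cast hb ha)) = 1 → cls x x (.mk γ.symm) = 1 := by
    rintro a b rfl rfl h
    exact h
  have h3 : γ.subpath 1 0 = γ.symm.cast γ.target γ.source := by
    rw [← Path.symm_subpath, Path.subpath_zero_one]
    rfl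
  have h4 : cls x x (.mk γ.symm) = 1 := by
    refine hcast _ _ γ.source γ.target ?_
    rw [← h3]
    exact e1
  have h5 := hone x _ h4
  have h6 : γ.symm.Homotopic (Path.refl x) := Path.Homotopic.Quotient.eq.1 h5
  simpa using h6.symm₂

/-- The set of connected components of a set. -/
def componentsIn {X : Type*} [TopologicalSpace X] (V : Set X) : Set (Set X) :=
  {D | ∃ x ∈ V, D = connectedComponentIn V x}

theorem isOpen_sdiff_connectedComponentIn {X : Type*} [TopologicalSpace X]
    [LocallyConnectedSpace X] {V : Set X} (hV : IsOpen V) (x : X) :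
    IsOpen (V \ connectedComponentIn V x) := by
  refine isOpen_iff_forall_mem_open.2 fun y hy ↦ ⟨connectedComponentIn V y, fun z hz ↦
    ⟨connectedComponentIn_subset _ _ hz, fun hzx ↦ hy.2 ?_⟩, hV.connectedComponentIn,
    mem_connectedComponentIn hy.1⟩
  rw [connectedComponentIn_eq hzx, ← connectedComponentIn_eq hz]
  exact mem_connectedComponentIn hy.1

section Log

open Complex

/-- Two continuous logarithms of the same function differ by a constant period. -/
theorem IsPreconnected.exists_eqOn_add_of_exp_eq {X : Type*} [TopologicalSpace X] {S : Set X}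
    (hS : IsPreconnected S) {f g : X → ℂ} (hf : ContinuousOn f S) (hg : ContinuousOn g S)
    (hfg : ∀ x ∈ S, exp (f x) = exp (g x)) :
    ∃ k : ℤ, ∀ x ∈ S, f x = g x + k * (2 * Real.pi * I) := by
  obtain ⟨_, ⟨k, rfl⟩, hk⟩ := hS.eqOn_const_of_mapsTo (f := fun x ↦ (f x - g x) / (2 * Real.pi * I))
    Complex.isClosedEmbedding_intCast.isEmbedding.isDiscrete_range
    ((hf.sub hg).div_const _) (fun x hx ↦ by
      obtain ⟨k, hk⟩ := exp_eq_exp_iff_exists_int.1 (hfg x hx)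
      exact ⟨k, by simp only [hk, add_sub_cancel_left, mul_div_cancel_right₀ _ two_pi_I_ne_zero]⟩)
    ⟨_, 0, rfl⟩
  refine ⟨k, fun x hx ↦ ?_⟩
  have := hk hx
  simp only [Function.const_apply, div_eq_iff two_pi_I_ne_zero] at this
  linear_combination this

theorem not_exists_continuousOn_log : ¬ ∃ L : ℂ → ℂ, ContinuousOn L {0}ᶜ ∧
    ∀ z ∈ ({0}ᶜ : Set ℂ), exp (L z) = z := by
  rintro ⟨L, hL, hexp⟩
  have hc : Continuous fun t : ℝ ↦ L (exp (t * I)) :=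
    hL.comp_continuous (by fun_prop) fun t ↦ exp_ne_zero _
  obtain ⟨k, hk⟩ := isPreconnected_univ.exists_eqOn_add_of_exp_eq hc.continuousOn
    (g := fun t : ℝ ↦ t * I) (by fun_prop) fun t _ ↦ hexp _ (exp_ne_zero _)
  have h0 := hk 0 trivial
  have h1 := hk (2 * Real.pi) trivial
  have h2 : exp ((2 * Real.pi : ℝ) * I) = exp ((0 : ℝ) * I) := by
    push_cast
    rw [exp_two_pi_mul_I, zero_mul, exp_zero]
  rw [h2, h0] at h1
  push_cast at h1
  exact two_pi_I_ne_zero (by linear_combination -h1)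

theorem isSimplyConnected_univ_complex : IsSimplyConnected (univ : Set ℂ) :=
  (Homeomorph.Set.univ ℂ).toHomotopyEquiv.simplyConnectedSpace

theorem not_isPreconnected_inter {A B : Set ℂ} (hA : IsOpen A) (hB : IsOpen B)
    (hAB : A ∪ B = {0}ᶜ) {LA LB : ℂ → ℂ} (hLA : ContinuousOn LA A) (hLB : ContinuousOn LB B)
    (heA : ∀ z ∈ A, exp (LA z) = z) (heB : ∀ z ∈ B, exp (LB z) = z) :
    ¬ IsPreconnected (A ∩ B) := by
  classical
  intro hV
  obtain ⟨k, hk⟩ := hV.exists_eqOn_add_of_exp_eq (hLA.mono inter_subset_left)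
    (hLB.mono inter_subset_right) fun z hz ↦ (heA z hz.1).trans (heB z hz.2).symm
  have hLB' : EqOn (A.piecewise LA fun z ↦ LB z + k * (2 * Real.pi * I))
      (fun z ↦ LB z + k * (2 * Real.pi * I)) B := fun z hz ↦ by
    by_cases hzA : z ∈ A
    · simpa [hzA] using hk z ⟨hzA, hz⟩
    · simp [hzA]
  refine not_exists_continuousOn_log ⟨A.piecewise LA fun z ↦ LB z + k * (2 * Real.pi * I), ?_, ?_⟩
  · rw [← hAB]
    exact (hLA.congr (piecewise_eqOn _ _ _)).union_of_isOpen
      ((hLB.add continuousOn_const).congr hLB') hA hB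
  · rw [← hAB]
    rintro z (hz | hz)
    · rw [piecewise_eq_of_mem _ _ _ hz, heA z hz]
    · rw [hLB' hz, exp_add, heB z hz, exp_int_mul_two_pi_mul_I, mul_one]

/-- The indicator function of a relatively clopen subset of `A ∩ B` is an affine function of the
difference of the branches of the logarithm on `A` and `B`. -/
theorem exists_indicator_eq_mul_add {A B : Set ℂ} (hA : IsOpen A) (hB : IsOpen B)
    (hAc : IsPreconnected A) (hBc : IsPreconnected B)
    (hAB : A ∪ B = {0}ᶜ) {LA LB : ℂ → ℂ} (hLA : ContinuousOn LA A) (hLB : ContinuousOn LB B)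
    (heA : ∀ z ∈ A, exp (LA z) = z) (heB : ∀ z ∈ B, exp (LB z) = z) {W : Set ℂ}
    (hWo : IsOpen W) (hWo' : IsOpen ((A ∩ B) \ W)) :
    ∃ k c : ℤ, ∀ z ∈ A ∩ B, ∀ m : ℤ, LA z = LB z + m * (2 * Real.pi * I) →
      (z ∈ W → k * m + c = 1) ∧ (z ∉ W → k * m + c = 0) := by
  classical
  have hA0 : (0 : ℂ) ∉ A := fun h ↦ (hAB ▸ Or.inl h : (0 : ℂ) ∈ ({0}ᶜ : Set ℂ)) rfl
  have hB0 : (0 : ℂ) ∉ B := fun h ↦ (hAB ▸ Or.inr h : (0 : ℂ) ∈ ({0}ᶜ : Set ℂ)) rfl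
  let χ : ℂ → ℝ := fun z ↦ Metric.infDist z Bᶜ / (Metric.infDist z Aᶜ + Metric.infDist z Bᶜ)
  have hden : ∀ z ∈ ({0}ᶜ : Set ℂ), Metric.infDist z Aᶜ + Metric.infDist z Bᶜ ≠ 0 := by
    intro z hz
    rw [← hAB] at hz
    rcases hz with hz | hz
    · have := (hA.isClosed_compl.notMem_iff_infDist_pos ⟨0, hA0⟩).1 (notMem_compl_iff.2 hz)
      have := Metric.infDist_nonneg (x := z) (s := Bᶜ)
      positivity
    · have := (hB.isClosed_compl.notMem_iff_infDist_pos ⟨0, hB0⟩).1 (notMem_compl_iff.2 hz)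
      have := Metric.infDist_nonneg (x := z) (s := Aᶜ)
      positivity
  have hχ : ContinuousOn χ {0}ᶜ := (Metric.continuous_infDist_pt _).continuousOn.div
    ((Metric.continuous_infDist_pt _).add (Metric.continuous_infDist_pt _)).continuousOn hden
  have hχA : ContinuousOn χ A := hχ.mono (hAB ▸ subset_union_left)
  have hχB : ContinuousOn χ B := hχ.mono (hAB ▸ subset_union_right)
  have hχ0 : ∀ z, z ∉ B → χ z = 0 := fun z hz ↦ by
    simp only [χ, Metric.infDist_zero_of_mem (mem_compl hz), zero_div]
  have hχ1 : ∀ z ∈ B, z ∉ A → χ z = 1 := fun z hz hzA ↦ by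
    have := hden z (hAB ▸ Or.inr hz)
    simp only [χ, Metric.infDist_zero_of_mem (mem_compl hzA), zero_add] at this ⊢
    exact div_self this
  have hfr : ∀ z ∈ frontier W, z ∉ A ∩ B := by
    intro z hz hzV
    rw [hWo.frontier_eq] at hz
    exact (disjoint_sdiff_left.closure_right hWo').le_bot ⟨⟨hzV, hz.2⟩, hz.1⟩
  let hfA : ℂ → ℂ := W.piecewise (fun z ↦ χ z * (2 * Real.pi * I)) fun _ ↦ 0
  let hfB : ℂ → ℂ := W.piecewise (fun z ↦ (χ z - 1) * (2 * Real.pi * I)) fun _ ↦ 0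
  let g : ℂ → ℂ := W.piecewise (fun z ↦ exp (χ z * (2 * Real.pi * I))) fun _ ↦ 1
  have hcA : ContinuousOn hfA A := by
    refine ContinuousOn.piecewise (fun z hz ↦ ?_) ?_ continuousOn_const
    · simp [hχ0 z fun h ↦ hfr z hz.2 ⟨hz.1, h⟩]
    · exact ((continuous_ofReal.comp_continuousOn hχA).mul continuousOn_const).mono
        inter_subset_left
  have hcB : ContinuousOn hfB B := by
    refine ContinuousOn.piecewise (fun z hz ↦ ?_) ?_ continuousOn_const
    · simp [hχ1 z hz.1 fun h ↦ hfr z hz.2 ⟨h, hz.1⟩]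
    · exact (((continuous_ofReal.comp_continuousOn hχB).sub continuousOn_const).mul
        continuousOn_const).mono inter_subset_left
  have hgA : ∀ z, exp (hfA z) = g z := fun z ↦ by
    by_cases hz : z ∈ W <;> simp [hfA, g, hz]
  have hgB : ∀ z, exp (hfB z) = g z := fun z ↦ by
    by_cases hz : z ∈ W <;> simp [hfB, g, hz, sub_mul, exp_sub]
  have hg : ContinuousOn g {0}ᶜ := by
    rw [← hAB]
    exact (hcA.cexp.congr fun z _ ↦ (hgA z).symm).union_of_isOpen
      (hcB.cexp.congr fun z _ ↦ (hgB z).symm) hA hB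
  obtain ⟨H, hHc, hH⟩ := exists_continuousOn_eqOn_exp_comp isSimplyConnected_univ_complex
    isOpen_univ (g := fun w ↦ g (exp w))
    (hg.comp_continuous continuous_exp exp_ne_zero).continuousOn (by
      rintro ⟨w, -, hw⟩
      simp only [← hgA] at hw
      exact exp_ne_zero _ hw)
  rw [continuousOn_univ] at hHc
  replace hH : ∀ w, exp (H w) = g (exp w) := fun w ↦ hH trivial
  obtain ⟨k, hk⟩ := isPreconnected_univ.exists_eqOn_add_of_exp_eq
    (f := fun w ↦ H (w + 2 * Real.pi * I)) (g := H) (by fun_prop) hHc.continuousOn fun w _ ↦ by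
      rw [hH, hH, exp_add, exp_two_pi_mul_I, mul_one]
  have hkm : ∀ (m : ℤ) w, H (w + m * (2 * Real.pi * I)) = H w + (k * m : ℤ) * (2 * Real.pi * I) := by
    intro m
    induction m with
    | zero => intro w; simp
    | succ n ih =>
      intro w
      have := hk (w + n * (2 * Real.pi * I)) trivial
      have hn := ih w
      push_cast at hn ⊢
      rw [add_mul, one_mul, ← add_assoc, this, hn]
      ring
    | pred n ih =>
      intro w
      have := hk (w + (-n - 1) * (2 * Real.pi * I)) trivial
      have hn := ih w
      push_cast at hn ⊢
      rw [show w + (-n - 1) * (2 * Real.pi * I) + 2 * Real.pi * I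
        = w + -n * (2 * Real.pi * I) by ring, hn] at this
      linear_combination -this
  obtain ⟨a, ha⟩ := hAc.exists_eqOn_add_of_exp_eq (hHc.comp_continuousOn hLA) hcA fun z hz ↦ by
    rw [Function.comp_apply, hH, heA z hz, hgA]
  obtain ⟨b, hb⟩ := hBc.exists_eqOn_add_of_exp_eq (hHc.comp_continuousOn hLB) hcB fun z hz ↦ by
    rw [Function.comp_apply, hH, heB z hz, hgB]
  refine ⟨k, b - a, fun z hz m hm ↦ ?_⟩
  have hza := ha z hz.1
  have hzb := hb z hz.2
  rw [Function.comp_apply, hm, hkm] at hza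
  rw [Function.comp_apply] at hzb
  constructor <;> intro hzW
  · simp only [hfA, hfB, piecewise_eq_of_mem _ _ _ hzW] at hza hzb
    have : ((k * m + (b - a) : ℤ) : ℂ) * (2 * Real.pi * I) = (1 : ℤ) * (2 * Real.pi * I) := by
      push_cast at hza ⊢
      linear_combination hza - hzb
    exact_mod_cast mul_right_cancel₀ two_pi_I_ne_zero this
  · simp only [hfA, hfB, piecewise_eq_of_notMem _ _ _ hzW] at hza hzb
    have : ((k * m + (b - a) : ℤ) : ℂ) * (2 * Real.pi * I) = (0 : ℤ) * (2 * Real.pi * I) := by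
      push_cast at hza ⊢
      linear_combination hza - hzb
    exact_mod_cast mul_right_cancel₀ two_pi_I_ne_zero this

/-- If two simply connected open sets cover the punctured plane, then their intersection has
exactly two connected components. -/
theorem ncard_componentsIn_inter_of_union_eq_compl_zero {A B : Set ℂ} (hA : IsOpen A)
    (hB : IsOpen B) (hAs : IsSimplyConnected A) (hBs : IsSimplyConnected B)
    (hAB : A ∪ B = {0}ᶜ) : (componentsIn (A ∩ B)).ncard = 2 := by
  have hA0 : (0 : ℂ) ∉ A := fun h ↦ (hAB ▸ Or.inl h : (0 : ℂ) ∈ ({0}ᶜ : Set ℂ)) rfl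
  have hB0 : (0 : ℂ) ∉ B := fun h ↦ (hAB ▸ Or.inr h : (0 : ℂ) ∈ ({0}ᶜ : Set ℂ)) rfl
  obtain ⟨LA, hLA, heA⟩ := exists_continuousOn_eqOn_exp_comp hAs hA (g := id) continuousOn_id
    (by simpa using hA0)
  obtain ⟨LB, hLB, heB⟩ := exists_continuousOn_eqOn_exp_comp hBs hB (g := id) continuousOn_id
    (by simpa using hB0)
  have hm : ∀ z ∈ A ∩ B, ∃ m : ℤ, LA z = LB z + m * (2 * Real.pi * I) := fun z hz ↦
    exp_eq_exp_iff_exists_int.1 ((heA hz.1).trans (heB hz.2).symm)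
  have key : ∀ x, ∃ k c : ℤ, ∀ z ∈ A ∩ B, ∀ m : ℤ, LA z = LB z + m * (2 * Real.pi * I) →
      (z ∈ connectedComponentIn (A ∩ B) x → k * m + c = 1) ∧
      (z ∉ connectedComponentIn (A ∩ B) x → k * m + c = 0) := fun x ↦
    exists_indicator_eq_mul_add hA hB hAs.isPathConnected.isConnected.isPreconnected
      hBs.isPathConnected.isConnected.isPreconnected hAB hLA hLB heA heB
      (hA.inter hB).connectedComponentIn
      (isOpen_sdiff_connectedComponentIn (hA.inter hB) x)
  have hnot := not_isPreconnected_inter hA hB hAB hLA hLB heA heB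
  obtain ⟨x, hx⟩ : (A ∩ B).Nonempty := nonempty_iff_ne_empty.2 fun h ↦
    hnot (h ▸ isPreconnected_empty)
  obtain ⟨y, hy, hyx⟩ : ∃ y ∈ A ∩ B, y ∉ connectedComponentIn (A ∩ B) x := by
    by_contra! h
    exact hnot ((connectedComponentIn_subset _ x).antisymm h ▸ isPreconnected_connectedComponentIn)
  have hxy : x ∉ connectedComponentIn (A ∩ B) y := fun h ↦ by
    rw [← connectedComponentIn_eq h] at hyx
    exact hyx (mem_connectedComponentIn hy)
  have hall : ∀ z ∈ A ∩ B, z ∈ connectedComponentIn (A ∩ B) x ∨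
      z ∈ connectedComponentIn (A ∩ B) y := by
    by_contra! ⟨z, hz, hzx, hzy⟩
    obtain ⟨mx, hmx⟩ := hm x hx
    obtain ⟨my, hmy⟩ := hm y hy
    obtain ⟨mz, hmz⟩ := hm z hz
    obtain ⟨k, c, hkc⟩ := key x
    obtain ⟨k', c', hkc'⟩ := key y
    have e1 := (hkc x hx mx hmx).1 (mem_connectedComponentIn hx)
    have e2 := (hkc y hy my hmy).2 hyx
    have e3 := (hkc z hz mz hmz).2 hzx
    have e4 := (hkc' x hx mx hmx).2 hxy
    have e5 := (hkc' y hy my hmy).1 (mem_connectedComponentIn hy)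
    have e6 := (hkc' z hz mz hmz).2 hzy
    have h1 : k * (my - mz) = 0 := by linear_combination e2 - e3
    rcases mul_eq_zero.1 h1 with h | h
    · rw [h] at e1 e2
      omega
    · rw [sub_eq_zero.1 h] at e5
      omega
  have : componentsIn (A ∩ B) =
      {connectedComponentIn (A ∩ B) x, connectedComponentIn (A ∩ B) y} := by
    ext D
    constructor
    · rintro ⟨z, hz, rfl⟩
      exact (hall z hz).imp (fun h ↦ (connectedComponentIn_eq h).symm)
        fun h ↦ (connectedComponentIn_eq h).symm
    · rintro (rfl | rfl)
      exacts [⟨x, hx, rfl⟩, ⟨y, hy, rfl⟩]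
  rw [this]
  exact ncard_pair fun h ↦ hyx (h.symm ▸ mem_connectedComponentIn hy)

end Log

section Components

variable {X Y : Type*} [TopologicalSpace X] [TopologicalSpace Y]

theorem Topology.IsInducing.image_connectedComponentIn {f : X → Y} (hf : IsInducing f)
    {V : Set X} {x : X} (hx : x ∈ V) :
    f '' connectedComponentIn V x = connectedComponentIn (f '' V) (f x) := by
  apply Subset.antisymm
  · exact (isPreconnected_connectedComponentIn.image f hf.continuous.continuousOn)
      |>.subset_connectedComponentIn (mem_image_of_mem f (mem_connectedComponentIn hx))
      (image_mono (connectedComponentIn_subset _ _))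
  · have himg : f '' (V ∩ f ⁻¹' connectedComponentIn (f '' V) (f x)) =
        connectedComponentIn (f '' V) (f x) := by
      rw [image_inter_preimage, inter_eq_right]
      exact connectedComponentIn_subset _ _
    rw [← himg]
    refine image_mono (IsPreconnected.subset_connectedComponentIn ?_
      ⟨hx, mem_connectedComponentIn (mem_image_of_mem f hx)⟩ inter_subset_left)
    rw [← hf.isPreconnected_image, himg]
    exact isPreconnected_connectedComponentIn

theorem Topology.IsEmbedding.ncard_componentsIn_image {f : X → Y} (hf : IsEmbedding f)
    (V : Set X) : (componentsIn (f '' V)).ncard = (componentsIn V).ncard := by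
  rw [← ncard_image_of_injective (componentsIn V) hf.injective.image_injective]
  congr 1
  ext D
  constructor
  · rintro ⟨_, ⟨x, hx, rfl⟩, rfl⟩
    exact ⟨_, ⟨x, hx, rfl⟩, hf.isInducing.image_connectedComponentIn hx⟩
  · rintro ⟨_, ⟨x, hx, rfl⟩, rfl⟩
    exact ⟨f x, mem_image_of_mem f hx, hf.isInducing.image_connectedComponentIn hx⟩

theorem IsConnected.ncard_componentsIn {V : Set X} (hV : IsConnected V) :
    (componentsIn V).ncard = 1 := by
  obtain ⟨x, hx⟩ := hV.nonempty
  refine ncard_eq_one.2 ⟨V, ?_⟩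
  ext D
  constructor
  · rintro ⟨y, hy, rfl⟩
    exact hV.isPreconnected.connectedComponentIn hy
  · rintro rfl
    exact ⟨x, hx, (hV.isPreconnected.connectedComponentIn hx).symm⟩

/-- Removing from `U` a set contained in a single component only affects this component. -/
theorem componentsIn_sdiff_eq_union {U B : Set X} {x : X} (hB : U ∩ B ⊆ connectedComponentIn U x) :
    componentsIn (U \ B) = (componentsIn U \ {connectedComponentIn U x}) ∪
      componentsIn (connectedComponentIn U x \ B) := by
  have hsub : connectedComponentIn U x ⊆ U := connectedComponentIn_subset _ _
  have hin : ∀ y ∈ connectedComponentIn U x \ B,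
      connectedComponentIn (U \ B) y = connectedComponentIn (connectedComponentIn U x \ B) y := by
    intro y hy
    refine Subset.antisymm (isPreconnected_connectedComponentIn.subset_connectedComponentIn
      (mem_connectedComponentIn (⟨hsub hy.1, hy.2⟩ : y ∈ U \ B)) fun z hz ↦
        ⟨?_, (connectedComponentIn_subset _ _ hz).2⟩)
      (connectedComponentIn_mono _ (sdiff_subset_sdiff_left hsub))
    rw [connectedComponentIn_eq hy.1]
    exact connectedComponentIn_mono _ sdiff_subset hz
  have hout : ∀ y ∈ U, y ∉ connectedComponentIn U x → y ∉ B ∧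
      connectedComponentIn (U \ B) y = connectedComponentIn U y := by
    intro y hy hyx
    refine ⟨fun h ↦ hyx (hB ⟨hy, h⟩), (connectedComponentIn_mono _ sdiff_subset).antisymm
      (isPreconnected_connectedComponentIn.subset_connectedComponentIn
      (mem_connectedComponentIn hy) fun z hz ↦ ⟨connectedComponentIn_subset _ _ hz, fun hzB ↦ ?_⟩)⟩
    have hzx := hB ⟨connectedComponentIn_subset _ _ hz, hzB⟩
    rw [connectedComponentIn_eq hzx, ← connectedComponentIn_eq hz] at hyx
    exact hyx (mem_connectedComponentIn hy)
  ext D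
  constructor
  · rintro ⟨y, hy, rfl⟩
    by_cases hyx : y ∈ connectedComponentIn U x
    · exact Or.inr ⟨y, ⟨hyx, hy.2⟩, hin y ⟨hyx, hy.2⟩⟩
    · refine Or.inl ⟨⟨y, hy.1, (hout y hy.1 hyx).2⟩, fun h ↦ hyx ?_⟩
      rw [mem_singleton_iff] at h
      rw [← h]
      exact mem_connectedComponentIn hy
  · rintro (⟨⟨y, hy, rfl⟩, hne⟩ | ⟨y, hy, rfl⟩)
    · have hyx : y ∉ connectedComponentIn U x := fun h ↦ hne (connectedComponentIn_eq h).symm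
      exact ⟨y, ⟨hy, (hout y hy hyx).1⟩, (hout y hy hyx).2.symm⟩
    · exact ⟨y, ⟨hsub hy.1, hy.2⟩, (hin y hy).symm⟩

theorem disjoint_componentsIn_sdiff {U B : Set X} {x : X} :
    Disjoint (componentsIn U \ {connectedComponentIn U x})
      (componentsIn (connectedComponentIn U x \ B)) := by
  rw [disjoint_left]
  rintro D ⟨⟨y, hy, rfl⟩, hne⟩ ⟨z, hz, hD⟩
  have hzy : z ∈ connectedComponentIn U y := hD ▸ mem_connectedComponentIn hz
  exact hne ((connectedComponentIn_eq hzy).trans (connectedComponentIn_eq hz.1).symm)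

/-- In a connected and locally connected space, the complement of a component of the complement of
a connected closed set is connected. -/
theorem IsConnected.isConnected_compl_connectedComponentIn [LocallyConnectedSpace X]
    [PreconnectedSpace X] {K : Set X} (hKc : IsConnected K) (hK : IsClosed K) (x : X) :
    IsConnected (connectedComponentIn Kᶜ x)ᶜ := by
  obtain ⟨a, ha⟩ := hKc.nonempty
  have hKsub : K ⊆ (connectedComponentIn Kᶜ x)ᶜ :=
    subset_compl_comm.1 (connectedComponentIn_subset _ _)
  refine ⟨⟨a, hKsub ha⟩, isPreconnected_of_forall a fun y hy ↦ ?_⟩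
  by_cases hyK : y ∈ K
  · exact ⟨K, hKsub, ha, hyK, hKc.isPreconnected⟩
  have hyy : y ∈ connectedComponentIn Kᶜ y := mem_connectedComponentIn hyK
  obtain ⟨z, hz, hzK⟩ : (closure (connectedComponentIn Kᶜ y) ∩ K).Nonempty := by
    by_contra hne
    have hcl : closure (connectedComponentIn Kᶜ y) ⊆ connectedComponentIn Kᶜ y :=
      isPreconnected_connectedComponentIn.closure.subset_connectedComponentIn (subset_closure hyy)
        fun z hz hzK ↦ hne ⟨z, hz, hzK⟩
    have huniv := IsClopen.eq_univ ⟨isClosed_of_closure_subset hcl,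
      hK.isOpen_compl.connectedComponentIn⟩ ⟨y, hyy⟩
    exact connectedComponentIn_subset Kᶜ y (huniv ▸ mem_univ a) ha
  refine ⟨insert z (connectedComponentIn Kᶜ y) ∪ K,
    union_subset (insert_subset (hKsub hzK) fun w hw hwx ↦ hy ?_) hKsub, Or.inr ha,
    Or.inl (mem_insert_of_mem _ hyy), ?_⟩
  · rw [connectedComponentIn_eq hwx, ← connectedComponentIn_eq hw]
    exact hyy
  · exact (isPreconnected_connectedComponentIn.subset_closure (subset_insert _ _)
      (insert_subset hz subset_closure)).union z (mem_insert _ _) hzK hKc.isPreconnected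

end Components

section Sphere

theorem OnePoint.exists_homeomorph_sphere (v : Metric.sphere (0 : EuclideanSpace ℝ (Fin 3)) 1) :
    ∃ e : OnePoint ℂ ≃ₜ Metric.sphere (0 : EuclideanSpace ℝ (Fin 3)) 1, e ∞ = v := by
  have hv : ‖(v : EuclideanSpace ℝ (Fin 3))‖ = 1 := by simp
  have hv₀ : (v : EuclideanSpace ℝ (Fin 3)) ≠ 0 := fun h ↦ by simp [h] at hv
  have : Fact (Module.finrank ℝ (EuclideanSpace ℝ (Fin 3)) = 2 + 1) := ⟨by simp⟩
  have hrank : Module.finrank ℝ ℂ =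
      Module.finrank ℝ (Submodule.span ℝ {(v : EuclideanSpace ℝ (Fin 3))})ᗮ := by
    rw [Submodule.finrank_orthogonal_span_singleton (n := 2) hv₀, Complex.finrank_real_complex]
  obtain ⟨e⟩ := FiniteDimensional.nonempty_continuousLinearEquiv_of_finrank_eq hrank
  exact ⟨e.toHomeomorph.onePointCongr.trans (onePointHyperplaneHomeoUnitSphere hv), rfl⟩

instance OnePoint.locallyConnectedSpace_complex : LocallyConnectedSpace (OnePoint ℂ) := by
  have : Fact (Module.finrank ℝ (EuclideanSpace ℝ (Fin 3)) = 2 + 1) := ⟨by simp⟩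
  let := EuclideanSpace.instChartedSpaceSphere (n := 2) (E := EuclideanSpace ℝ (Fin 3))
  have := ChartedSpace.locallyConnectedSpace (EuclideanSpace ℝ (Fin 2))
    (Metric.sphere (0 : EuclideanSpace ℝ (Fin 3)) 1)
  obtain ⟨e, -⟩ := exists_homeomorph_sphere ⟨EuclideanSpace.single 0 1, by simp⟩
  exact e.locallyConnectedSpace

theorem OnePoint.exists_homeomorph_map_infty (q : OnePoint ℂ) :
    ∃ e : OnePoint ℂ ≃ₜ OnePoint ℂ, e q = ∞ := by
  obtain ⟨e₀, -⟩ := exists_homeomorph_sphere ⟨EuclideanSpace.single 0 1, by simp⟩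
  obtain ⟨e, he⟩ := exists_homeomorph_sphere (e₀ q)
  exact ⟨e₀.trans e.symm, by simp [← he]⟩

/-- Any two distinct points of the sphere can be moved to `0` and `∞`. -/
theorem OnePoint.exists_isEmbedding_map_zero {p q : OnePoint ℂ} (hpq : p ≠ q) :
    ∃ f : ℂ → OnePoint ℂ, IsEmbedding f ∧ range f = {q}ᶜ ∧ f 0 = p := by
  obtain ⟨e, he⟩ := exists_homeomorph_map_infty q
  obtain ⟨a, ha⟩ := ne_infty_iff_exists.1 (fun h ↦ hpq (e.injective (h.trans he.symm)) : e p ≠ ∞)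
  refine ⟨fun z ↦ e.symm ((z + a : ℂ) : OnePoint ℂ), e.symm.isEmbedding.comp
    (isOpenEmbedding_coe.isEmbedding.comp (Homeomorph.addRight a).isEmbedding), ?_, by simp [ha]⟩
  ext x
  simp only [mem_range, e.symm_apply_eq, mem_compl_iff, mem_singleton_iff]
  rw [← ne_eq, ← e.injective.ne_iff, he, ne_infty_iff_exists]
  exact ⟨fun ⟨z, hz⟩ ↦ ⟨z + a, hz⟩, fun ⟨z, hz⟩ ↦ ⟨z - a, by rw [sub_add_cancel, hz]⟩⟩

/-- A connected open subset of the sphere with nonempty connected complement is simply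
connected. -/
theorem isSimplyConnected_of_isConnected_compl {D : Set (OnePoint ℂ)} (hD : IsOpen D)
    (hDconn : IsConnected D) (hDc : IsConnected Dᶜ) : IsSimplyConnected D := by
  obtain ⟨q, hq⟩ := hDc.nonempty
  obtain ⟨e, he⟩ := OnePoint.exists_homeomorph_map_infty q
  have himg : (↑) '' ((↑) ⁻¹' (e '' D) : Set ℂ) = e '' D := by
    rw [image_preimage_eq_iff]
    rintro _ ⟨x, hx, rfl⟩
    exact ne_infty_iff_exists.1 fun h ↦ hq (e.injective (h.trans he.symm) ▸ hx)
  rw [← e.isSimplyConnected_image, ← himg, isOpenEmbedding_coe.isEmbedding.isSimplyConnected_image]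
  refine isSimplyConnected_of_isPreconnected_compl
    ((e.isOpenMap _ hD).preimage continuous_coe) ?_ ?_
  · have hconn := hDconn.image e e.continuous.continuousOn
    rw [← himg] at hconn
    exact ⟨hconn.nonempty.of_image,
      isOpenEmbedding_coe.isEmbedding.isInducing.isPreconnected_image.1 hconn.isPreconnected⟩
  · rw [himg, ← image_compl_eq e.bijective]
    exact (hDc.image e e.continuous.continuousOn).isPreconnected

/-- Two non-separating connected closed sets meeting in exactly two points separate the sphere into
exactly two components. -/
theorem ncard_componentsIn_compl_union {A B : Set (OnePoint ℂ)} (hA : IsClosed A)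
    (hB : IsClosed B) (hAc : IsConnected A) (hBc : IsConnected B) (hAn : IsConnected Aᶜ)
    (hBn : IsConnected Bᶜ) {p q : OnePoint ℂ} (hpq : p ≠ q) (hAB : A ∩ B = {p, q}) :
    (componentsIn (A ∪ B)ᶜ).ncard = 2 := by
  obtain ⟨f, hf, hrange, hf0⟩ := OnePoint.exists_isEmbedding_map_zero hpq
  have hqA : q ∈ A := (hAB.ge (by simp) : q ∈ A ∩ B).1
  have hqB : q ∈ B := (hAB.ge (by simp) : q ∈ A ∩ B).2
  have himg : ∀ C : Set (OnePoint ℂ), q ∈ C → f '' (f ⁻¹' Cᶜ) = Cᶜ := fun C hC ↦ by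
    rw [image_preimage_eq_iff, hrange]
    exact compl_subset_compl.2 (singleton_subset_iff.2 hC)
  have hsc : ∀ C : Set (OnePoint ℂ), q ∈ C → IsClosed C → IsConnected C → IsConnected Cᶜ →
      IsSimplyConnected (f ⁻¹' Cᶜ) := fun C hC hCc hCn hCn' ↦ by
    rw [← hf.isSimplyConnected_image, himg C hC]
    exact isSimplyConnected_of_isConnected_compl hCc.isOpen_compl hCn' (by rwa [compl_compl])
  rw [← himg (A ∪ B) (Or.inl hqA), hf.ncard_componentsIn_image, compl_union, preimage_inter]
  refine ncard_componentsIn_inter_of_union_eq_compl_zero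
    (hA.isOpen_compl.preimage hf.continuous) (hB.isOpen_compl.preimage hf.continuous)
    (hsc A hqA hA hAc hAn) (hsc B hqB hB hBc hBn) ?_
  rw [← preimage_union, ← compl_inter, hAB, preimage_compl, compl_inj_iff]
  ext z
  have hzq : f z ≠ q := fun h ↦ (hrange.le (mem_range_self z)) h
  simp [hzq, ← hf0, hf.injective.eq_iff]

/-- Components of the complement of `n` continua meeting pairwise in the same two points. -/
theorem ncard_componentsIn_compl_iUnion {n : ℕ} (hn : 1 ≤ n) {p q : OnePoint ℂ} (hpq : p ≠ q)
    (C : Fin n → Set (OnePoint ℂ)) (hcl : ∀ i, IsClosed (C i)) (hc : ∀ i, IsConnected (C i))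
    (hns : ∀ i, IsConnected (C i)ᶜ) (hmem : ∀ i, p ∈ C i ∧ q ∈ C i)
    (hinter : ∀ i j, i ≠ j → C i ∩ C j = {p, q}) (hconn : ∀ i, IsConnected (C i \ {p, q})) :
    (componentsIn (⋃ i, C i)ᶜ).ncard = n := by
  induction n, hn using Nat.le_induction with
  | base =>
    rw [iUnion, ciSup_unique]
    exact (hns _).ncard_componentsIn
  | succ n hn ih =>
    have hne : Nonempty (Fin n) := ⟨⟨0, hn⟩⟩
    set K := ⋃ i : Fin n, C i.castSucc with hK
    set B := C (Fin.last n) with hBdef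
    have hKcl : IsClosed K := isClosed_iUnion_of_finite fun i ↦ hcl _
    have hpK : p ∈ K := mem_iUnion.2 ⟨hne.some, (hmem _).1⟩
    have hqK : q ∈ K := mem_iUnion.2 ⟨hne.some, (hmem _).2⟩
    have hKc : IsConnected K := ⟨⟨p, hpK⟩, isPreconnected_iUnion
      ⟨p, mem_iInter.2 fun i ↦ (hmem _).1⟩ fun i ↦ (hc _).isPreconnected⟩
    have hKcard : (componentsIn Kᶜ).ncard = n := ih (fun i ↦ C i.castSucc) (fun i ↦ hcl _)
      (fun i ↦ hc _) (fun i ↦ hns _) (fun i ↦ hmem _)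
      (fun i j hij ↦ hinter _ _ ((Fin.castSucc_injective n).ne hij)) fun i ↦ hconn _
    have hBK : B \ {p, q} ⊆ Kᶜ := by
      rintro x ⟨hxB, hx⟩ hxK
      obtain ⟨i, hi⟩ := mem_iUnion.1 hxK
      exact hx ((hinter _ _ (Fin.castSucc_lt_last i).ne).le ⟨hi, hxB⟩)
    obtain ⟨x, hx⟩ := (hconn (Fin.last n)).nonempty
    set D := connectedComponentIn Kᶜ x with hD
    have hBD : B \ {p, q} ⊆ D :=
      (hconn (Fin.last n)).isPreconnected.subset_connectedComponentIn hx hBK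
    have hDK : D ⊆ Kᶜ := connectedComponentIn_subset _ _
    have hDinter : Dᶜ ∩ B = {p, q} := by
      apply Subset.antisymm
      · rintro y ⟨hyD, hyB⟩
        by_contra hy
        exact hyD (hBD ⟨hyB, hy⟩)
      · rintro y (rfl | rfl)
        exacts [⟨fun h ↦ hDK h hpK, (hmem _).1⟩, ⟨fun h ↦ hDK h hqK, (hmem _).2⟩]
    have htwo := ncard_componentsIn_compl_union
      hKcl.isOpen_compl.connectedComponentIn.isClosed_compl (hcl (Fin.last n))
      (hKc.isConnected_compl_connectedComponentIn hKcl x) (hc _)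
      (by rw [compl_compl]; exact isConnected_connectedComponentIn_iff.2 (hBK hx)) (hns _)
      hpq hDinter
    rw [compl_union, compl_compl, ← sdiff_eq] at htwo
    have hunion : (⋃ i, C i)ᶜ = Kᶜ \ B := by
      ext y
      simp [K, B, Fin.forall_fin_succ']
    have hDmem : D ∈ componentsIn Kᶜ := ⟨x, hBK hx, rfl⟩
    have hUB : Kᶜ ∩ B ⊆ D := fun y hy ↦ hBD ⟨hy.2, by
      rintro (rfl | rfl)
      exacts [hy.1 hpK, hy.1 hqK]⟩
    rw [hunion, componentsIn_sdiff_eq_union hUB, ncard_union_eq disjoint_componentsIn_sdiff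
      (finite_of_ncard_ne_zero (by omega)).sdiff (finite_of_ncard_ne_zero (by rw [htwo]; simp)),
      ncard_sdiff_singleton_of_mem hDmem, htwo, hKcard]
    omega

end Sphere

theorem separation_n_continua_two_points
    (n : ℕ) (hn : 1 ≤ n) (p q : RSphere) (hpq : p ≠ q)
    (C : Fin n → Set RSphere)
    (hcont : ∀ i, IsContinuum (C i))
    (hns : ∀ i, NonSeparating (C i))
    (hmem : ∀ i, p ∈ C i ∧ q ∈ C i)
    (hinter : ∀ i j, i ≠ j → C i ∩ C j = {p, q})
    (hconn : ∀ i, IsConnected (C i \ {p, q})) :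
    {D : Set RSphere | ∃ x ∈ (⋃ i, C i)ᶜ, D = connectedComponentIn (⋃ i, C i)ᶜ x}.ncard = n ∧
      ∀ x ∈ (⋃ i, C i)ᶜ,
        IsOpen (connectedComponentIn (⋃ i, C i)ᶜ x) ∧
        SimplyConnectedSpace (connectedComponentIn (⋃ i, C i)ᶜ x) := by
  have hcl : ∀ i, IsClosed (C i) := fun i ↦ (hcont i).2.1.isClosed
  refine ⟨ncard_componentsIn_compl_iUnion hn hpq C hcl (fun i ↦ (hcont i).2.2)
    (fun i ↦ (hns i).2) hmem hinter hconn, fun x hx ↦ ?_⟩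
  have hUcl : IsClosed (⋃ i, C i) := isClosed_iUnion_of_finite hcl
  have hUc : IsConnected (⋃ i, C i) := ⟨⟨p, mem_iUnion.2 ⟨⟨0, hn⟩, (hmem _).1⟩⟩,
    isPreconnected_iUnion ⟨p, mem_iInter.2 fun i ↦ (hmem i).1⟩
      fun i ↦ (hcont i).2.2.isPreconnected⟩
  have hopen := hUcl.isOpen_compl.connectedComponentIn (x := x)
  exact ⟨hopen, isSimplyConnected_of_isConnected_compl hopen
    (isConnected_connectedComponentIn_iff.2 hx)
    (hUc.isConnected_compl_connectedComponentIn hUcl x)⟩
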